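/- Asymptotic stability from a constrained joint spectral radius below one. Let Σ be a finite nonempty alphabet, A : Σ → Matrix (Fin n) (Fin n) ℝ, and S a nonempty set of infinite sequences α : ℕ → Σ. If ρ(A, S) < 1, then for every α ∈ S and every x₀ ∈ ℝⁿ, the state trajectory x_ℓ := (A(α(ℓ-1)) ⋯ A(α 1) A(α 0)) · x₀ converges to 0 as ℓ → ∞. -/

import Mathlib

/-- Frobenius norm of a real `n × n` matrix. -/
noncomputable def frob {n : ℕ} (A : Matrix (Fin n) (Fin n) ℝ) : ℝ :=
  Real.sqrt (∑ i, ∑ j, (A i j) ^ 2)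

/-- Ordered product `A (α (ℓ-1)) * ⋯ * A (α 1) * A (α 0)` along the first `ℓ`
letters of the infinite word `α`. -/
noncomputable def wordProd {Γ : Type*} {n : ℕ} (A : Γ → Matrix (Fin n) (Fin n) ℝ)
    (α : ℕ → Γ) : ℕ → Matrix (Fin n) (Fin n) ℝ
  | 0 => 1
  | ℓ + 1 => A (α ℓ) * wordProd A α ℓ

/-- Constrained joint spectral radius of the family `A` along the set `S`. -/
noncomputable def cjsr {Γ : Type*} {n : ℕ} (A : Γ → Matrix (Fin n) (Fin n) ℝ)
    (S : Set (ℕ → Γ)) : ℝ :=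
  Filter.limsup
    (fun ℓ : ℕ => sSup {r : ℝ | ∃ α ∈ S, r = frob (wordProd A α ℓ) ^ ((1 : ℝ) / (ℓ : ℝ))})
    Filter.atTop

section Frobenius

attribute [local instance] Matrix.frobeniusSeminormedAddCommGroup

theorem frob_eq_norm {n : ℕ} (A : Matrix (Fin n) (Fin n) ℝ) : frob A = ‖A‖ := by
  rw [Matrix.frobenius_norm_def, frob, Real.sqrt_eq_rpow]
  simp

theorem frob_mul_le {n : ℕ} (A B : Matrix (Fin n) (Fin n) ℝ) :
    frob (A * B) ≤ frob A * frob B := by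
  simpa only [frob_eq_norm] using Matrix.frobenius_norm_mul A B

end Frobenius

theorem frob_nonneg {n : ℕ} (A : Matrix (Fin n) (Fin n) ℝ) : 0 ≤ frob A :=
  Real.sqrt_nonneg _

theorem abs_entry_le_frob {n : ℕ} (A : Matrix (Fin n) (Fin n) ℝ) (i j : Fin n) :
    |A i j| ≤ frob A := by
  refine Real.abs_le_sqrt ?_
  calc A i j ^ 2 ≤ ∑ j, A i j ^ 2 :=
        Finset.single_le_sum (f := fun j => A i j ^ 2) (fun _ _ => sq_nonneg _)
          (Finset.mem_univ j)
    _ ≤ ∑ i, ∑ j, A i j ^ 2 :=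
        Finset.single_le_sum (f := fun i => ∑ j, A i j ^ 2)
          (fun _ _ => Finset.sum_nonneg fun _ _ => sq_nonneg _) (Finset.mem_univ i)

theorem exists_frob_wordProd_le {Γ : Type*} [Fintype Γ] {n : ℕ}
    (A : Γ → Matrix (Fin n) (Fin n) ℝ) :
    ∃ K : ℝ, 1 ≤ K ∧ ∀ (α : ℕ → Γ) (ℓ : ℕ), frob (wordProd A α ℓ) ≤ K ^ (ℓ + 1) := by
  have hsum : 0 ≤ ∑ a, frob (A a) := Finset.sum_nonneg fun a _ => frob_nonneg (A a)
  have hone := frob_nonneg (1 : Matrix (Fin n) (Fin n) ℝ)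
  refine ⟨1 + frob (1 : Matrix (Fin n) (Fin n) ℝ) + ∑ a, frob (A a), by linarith,
    fun α ℓ => ?_⟩
  induction ℓ with
  | zero =>
    simp only [wordProd, zero_add, pow_one]
    linarith
  | succ ℓ ih =>
    have hle : frob (A (α ℓ)) ≤ 1 + frob (1 : Matrix (Fin n) (Fin n) ℝ) + ∑ a, frob (A a) := by
      have := Finset.single_le_sum (f := fun a => frob (A a)) (fun a _ => frob_nonneg (A a))
        (Finset.mem_univ (α ℓ))
      linarith
    rw [pow_succ' _ (ℓ + 1)]
    exact (frob_mul_le _ _).trans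
      (mul_le_mul hle ih (frob_nonneg _) ((frob_nonneg _).trans hle))

theorem exists_frob_wordProd_rpow_le {Γ : Type*} [Fintype Γ] {n : ℕ}
    (A : Γ → Matrix (Fin n) (Fin n) ℝ) :
    ∃ C : ℝ, 0 ≤ C ∧ ∀ (α : ℕ → Γ) (ℓ : ℕ),
      frob (wordProd A α ℓ) ^ ((1 : ℝ) / (ℓ : ℝ)) ≤ C := by
  obtain ⟨K, hK, hle⟩ := exists_frob_wordProd_le A
  refine ⟨K ^ 2, sq_nonneg K, fun α ℓ => ?_⟩
  rcases Nat.eq_zero_or_pos ℓ with rfl | hℓ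
  · simpa only [Nat.cast_zero, div_zero, Real.rpow_zero] using one_le_pow₀ hK
  · rw [one_div]
    refine (Real.rpow_inv_le_iff_of_pos (frob_nonneg _) (sq_nonneg K)
      (Nat.cast_pos.2 hℓ)).2 ?_
    rw [Real.rpow_natCast, ← pow_mul]
    exact (hle α ℓ).trans (pow_le_pow_right₀ hK (by omega))

theorem tendsto_frob_wordProd {Γ : Type*} [Fintype Γ] {n : ℕ}
    {A : Γ → Matrix (Fin n) (Fin n) ℝ} {S : Set (ℕ → Γ)} (hρ : cjsr A S < 1)
    {α : ℕ → Γ} (hα : α ∈ S) :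
    Filter.Tendsto (fun ℓ : ℕ => frob (wordProd A α ℓ)) Filter.atTop (nhds 0) := by
  obtain ⟨C, hC, hle⟩ := exists_frob_wordProd_rpow_le A
  obtain ⟨r, hr, hr1⟩ := exists_between (max_lt hρ one_pos)
  have hr0 : 0 < r := (le_max_right _ _).trans_lt hr
  have hbdd : Filter.IsBoundedUnder (· ≤ ·) Filter.atTop (fun ℓ : ℕ =>
      sSup {r : ℝ | ∃ α ∈ S, r = frob (wordProd A α ℓ) ^ ((1 : ℝ) / (ℓ : ℝ))}) := by
    refine Filter.isBoundedUnder_of ⟨C, fun ℓ => Real.sSup_le ?_ hC⟩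
    rintro _ ⟨β, -, rfl⟩
    exact hle β ℓ
  have hlt := Filter.eventually_lt_of_limsup_lt ((le_max_left _ _).trans_lt hr) hbdd
  refine squeeze_zero' (.of_forall fun ℓ => frob_nonneg _) ?_
    (tendsto_pow_atTop_nhds_zero_of_lt_one hr0.le hr1)
  filter_upwards [hlt, Filter.eventually_gt_atTop 0] with ℓ hℓ hpos
  have hroot : frob (wordProd A α ℓ) ^ ((1 : ℝ) / (ℓ : ℝ)) ≤ r := by
    refine hℓ.le.trans' (le_csSup ?_ ⟨α, hα, rfl⟩)
    refine ⟨C, ?_⟩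
    rintro _ ⟨β, -, rfl⟩
    exact hle β ℓ
  rwa [one_div, Real.rpow_inv_le_iff_of_pos (frob_nonneg _) hr0.le (Nat.cast_pos.2 hpos),
    Real.rpow_natCast] at hroot

/-- **Asymptotic stability from a constrained JSR below one.** If
`ρ(A, S) < 1`, then along every admissible switching sequence `α ∈ S` and from
every initial state `x₀`, the trajectory `x_ℓ = A_α^ℓ x₀` converges to `0`. -/
theorem asymptotic_stability {Γ : Type*} [Fintype Γ] [Nonempty Γ] {n : ℕ}
    (A : Γ → Matrix (Fin n) (Fin n) ℝ) (S : Set (ℕ → Γ)) (hne : S.Nonempty)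
    (hρ : cjsr A S < 1) :
    ∀ α ∈ S, ∀ x₀ : Fin n → ℝ,
      Filter.Tendsto (fun ℓ : ℕ => (wordProd A α ℓ).mulVec x₀)
        Filter.atTop (nhds 0) := by
  intro α hα x₀
  have hprod : Filter.Tendsto (wordProd A α) Filter.atTop (nhds 0) :=
    tendsto_pi_nhds.2 fun i => tendsto_pi_nhds.2 fun j =>
      squeeze_zero_norm (fun ℓ => abs_entry_le_frob (wordProd A α ℓ) i j)
        (tendsto_frob_wordProd hρ hα)
  have hcont : Continuous fun M : Matrix (Fin n) (Fin n) ℝ => M.mulVec x₀ := by fun_prop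
  simpa [Function.comp_def] using (hcont.tendsto 0).comp hprod
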